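/- arXiv:2509.17529 — 5 statements merged into one kernel-verified Lean document; each statement's English description precedes it below -/
import Mathlib

section
/- If f, g ∈ L¹(ℝⁿ), then the convolution f ⋆_ℋ g is well defined (its defining integral converges absolutely for almost every x ∈ ℝⁿ), belongs to L¹(ℝⁿ), and satisfies the norm inequality ‖f ⋆_ℋ g‖_{L¹(ℝⁿ)} ≤ ((|3a²−b²| + 3(a²+b²)) / (4|a|(2π)^{n/2})) ‖f‖_{L¹(ℝⁿ)} ‖g‖_{L¹(ℝⁿ)}. -/
open MeasureTheory Real Filter

noncomputable def Kab (n : ℕ) (a b : ℝ) (f : (Fin n → ℝ) → ℝ) (x v : Fin n → ℝ) : ℝ :=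
  (3 * a ^ 2 - b ^ 2) * f (x - v) +
    (a ^ 2 + b ^ 2) * (f (x + v) + f (-x + v) - f (-x - v))

noncomputable def Hconv (n : ℕ) (a b : ℝ) (f g : (Fin n → ℝ) → ℝ)
    (x : Fin n → ℝ) : ℝ :=
  (1 / (4 * a * (2 * Real.pi) ^ ((n : ℝ) / 2))) * ∫ v, Kab n a b f x v * g v

section

variable {G : Type*} [AddCommGroup G] [MeasurableSpace G] [MeasurableNeg G]
  {μ : Measure G} [SFinite μ] {f g : G → ℝ}

theorem measurePreserving_neg_fst [μ.IsNegInvariant] :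
    MeasurePreserving (fun p : G × G => (-p.1, p.2)) (μ.prod μ) (μ.prod μ) :=
  (Measure.measurePreserving_neg μ).prod (MeasurePreserving.id μ)

variable [MeasurableAdd₂ G] [μ.IsAddLeftInvariant]

theorem integrable_comp_sub_mul (hf : Integrable f μ) (hg : Integrable g μ) :
    Integrable (fun p : G × G => f (p.1 - p.2) * g p.2) (μ.prod μ) := by
  simpa [mul_comm] using hg.convolution_integrand (ContinuousLinearMap.mul ℝ ℝ) hf

theorem integral_abs_comp_sub_mul (hf : Integrable f μ) (hg : Integrable g μ) :
    ∫ p : G × G, |f (p.1 - p.2) * g p.2| ∂μ.prod μ = (∫ x, |f x| ∂μ) * ∫ x, |g x| ∂μ := by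
  rw [integral_prod_symm _ (integrable_comp_sub_mul hf hg).abs]
  simp only [abs_mul, integral_mul_const]
  simp only [integral_sub_right_eq_self (fun x => |f x|), integral_const_mul]

variable [μ.IsNegInvariant]

theorem integrable_comp_neg_sub_mul (hf : Integrable f μ) (hg : Integrable g μ) :
    Integrable (fun p : G × G => f (-p.1 - p.2) * g p.2) (μ.prod μ) :=
  measurePreserving_neg_fst.integrable_comp_of_integrable (integrable_comp_sub_mul hf hg)

theorem integral_abs_comp_neg_sub_mul (hf : Integrable f μ) (hg : Integrable g μ) :
    ∫ p : G × G, |f (-p.1 - p.2) * g p.2| ∂μ.prod μ = (∫ x, |f x| ∂μ) * ∫ x, |g x| ∂μ := by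
  rw [integral_prod_symm _ (integrable_comp_neg_sub_mul hf hg).abs]
  have h (y : G) : ∫ x, |f (-x - y)| ∂μ = ∫ x, |f x| ∂μ :=
    (integral_neg_eq_self (fun x => |f (x - y)|) μ).trans
      (integral_sub_right_eq_self (fun x => |f x|) y)
  simp only [abs_mul, integral_mul_const, h, integral_const_mul]

end

theorem Kab_mul_eq (n : ℕ) (a b : ℝ) (f g : (Fin n → ℝ) → ℝ) (x v : Fin n → ℝ) :
    Kab n a b f x v * g v = (3 * a ^ 2 - b ^ 2) * (f (x - v) * g v) +
      (a ^ 2 + b ^ 2) * (f (-(-x - v)) * g v + f (-(x - v)) * g v - f (-x - v) * g v) := by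
  have h₁ : -(-x - v) = x + v := by abel
  have h₂ : -(x - v) = -x + v := by abel
  rw [Kab, h₁, h₂]
  ring

theorem abs_Kab_mul_le (n : ℕ) (a b : ℝ) (f g : (Fin n → ℝ) → ℝ) (x v : Fin n → ℝ) :
    |Kab n a b f x v * g v| ≤ |3 * a ^ 2 - b ^ 2| * |f (x - v) * g v| +
      (a ^ 2 + b ^ 2) *
        (|f (-(-x - v)) * g v| + |f (-(x - v)) * g v| + |f (-x - v) * g v|) := by
  rw [Kab_mul_eq]
  refine (abs_add_le _ _).trans ?_
  rw [abs_mul, abs_mul (a ^ 2 + b ^ 2), abs_of_nonneg (by positivity : 0 ≤ a ^ 2 + b ^ 2)]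
  gcongr
  exact (abs_sub _ _).trans (by gcongr; exact abs_add_le _ _)

theorem integrable_Kab_mul (n : ℕ) (a b : ℝ) {f g : (Fin n → ℝ) → ℝ}
    (hf : Integrable f) (hg : Integrable g) :
    Integrable (fun p : (Fin n → ℝ) × (Fin n → ℝ) => Kab n a b f p.1 p.2 * g p.2)
      (volume.prod volume) := by
  simp only [Kab_mul_eq]
  exact ((integrable_comp_sub_mul hf hg).const_mul _).add
    ((((integrable_comp_neg_sub_mul hf.comp_neg hg).add
      (integrable_comp_sub_mul hf.comp_neg hg)).sub
      (integrable_comp_neg_sub_mul hf hg)).const_mul _)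

theorem integral_abs_Kab_mul_le (n : ℕ) (a b : ℝ) {f g : (Fin n → ℝ) → ℝ}
    (hf : Integrable f) (hg : Integrable g) :
    ∫ p : (Fin n → ℝ) × (Fin n → ℝ), |Kab n a b f p.1 p.2 * g p.2| ∂volume.prod volume ≤
      (|3 * a ^ 2 - b ^ 2| + 3 * (a ^ 2 + b ^ 2)) * ((∫ x, |f x|) * ∫ x, |g x|) := by
  have i₁ := (integrable_comp_sub_mul hf hg).abs
  have i₂ := (integrable_comp_neg_sub_mul hf.comp_neg hg).abs
  have i₃ := (integrable_comp_sub_mul hf.comp_neg hg).abs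
  have i₄ := (integrable_comp_neg_sub_mul hf hg).abs
  have hfn : ∫ x, |f (-x)| = ∫ x, |f x| := integral_neg_eq_self (fun x => |f x|) volume
  have e₂ := integral_abs_comp_neg_sub_mul hf.comp_neg hg
  have e₃ := integral_abs_comp_sub_mul hf.comp_neg hg
  refine (integral_mono (integrable_Kab_mul n a b hf hg).abs
    ((i₁.const_mul _).fun_add (((i₂.fun_add i₃).fun_add i₄).const_mul _))
    fun p => abs_Kab_mul_le n a b f g p.1 p.2).trans_eq ?_
  rw [integral_add (i₁.const_mul _) (((i₂.fun_add i₃).fun_add i₄).const_mul _), integral_const_mul,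
    integral_const_mul, integral_add (i₂.fun_add i₃) i₄, integral_add i₂ i₃,
    integral_abs_comp_sub_mul hf hg, integral_abs_comp_neg_sub_mul hf hg, e₂, e₃, hfn]
  ring

theorem stmt2 (n : ℕ) (hn : 1 ≤ n) (a b : ℝ) (ha : a ≠ 0)
    (hab : a ^ 2 + b ^ 2 ≠ 0) (hab1 : a ≠ b) (hab2 : a ≠ -b)
    (f g : (Fin n → ℝ) → ℝ) (hf : Integrable f volume) (hg : Integrable g volume) :
    (∀ᵐ x ∂(volume : Measure (Fin n → ℝ)),
        Integrable (fun v => Kab n a b f x v * g v) volume) ∧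
      Integrable (Hconv n a b f g) volume ∧
      ∫ x, |Hconv n a b f g x| ≤
        ((|3 * a ^ 2 - b ^ 2| + 3 * (a ^ 2 + b ^ 2)) /
            (4 * |a| * (2 * Real.pi) ^ ((n : ℝ) / 2))) *
          (∫ x, |f x|) * ∫ x, |g x| := by
  have hK := integrable_Kab_mul n a b hf hg
  refine ⟨hK.prod_right_ae, hK.integral_prod_left.const_mul _, ?_⟩
  have hc : |1 / (4 * a * (2 * Real.pi) ^ ((n : ℝ) / 2))| =
      1 / (4 * |a| * (2 * Real.pi) ^ ((n : ℝ) / 2)) := by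
    rw [abs_div, abs_mul, abs_mul, abs_one, abs_of_pos (by norm_num : (0 : ℝ) < 4),
      abs_of_pos (by positivity : 0 < (2 * Real.pi) ^ ((n : ℝ) / 2))]
  have hle : ∫ x, |∫ v, Kab n a b f x v * g v| ≤
      (|3 * a ^ 2 - b ^ 2| + 3 * (a ^ 2 + b ^ 2)) * ((∫ x, |f x|) * ∫ x, |g x|) := by
    refine le_trans ?_ (integral_abs_Kab_mul_le n a b hf hg)
    rw [integral_prod _ hK.abs]
    exact integral_mono hK.integral_prod_left.abs hK.abs.integral_prod_left
      fun x => abs_integral_le_integral_abs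
  simp only [Hconv]
  simp_rw [abs_mul (1 / _ : ℝ), hc, integral_const_mul]
  refine (mul_le_mul_of_nonneg_left hle (by positivity)).trans_eq ?_
  ring
end

section
/- If f, g ∈ L¹(ℝⁿ), then the ℋ-convolution is commutative: f ⋆_ℋ g = g ⋆_ℋ f almost everywhere on ℝⁿ. -/
open MeasureTheory Real Filter

theorem ae_integrable_sub_mul {n : ℕ} {f g : (Fin n → ℝ) → ℝ}
    (hf : Integrable f volume) (hg : Integrable g volume) :
    ∀ᵐ x ∂(volume : Measure (Fin n → ℝ)), Integrable (fun v => f (x - v) * g v) volume := by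
  filter_upwards [hg.ae_convolution_exists (ContinuousLinearMap.mul ℝ ℝ) hf] with x hx
  simpa [ConvolutionExistsAt, mul_comm] using hx

theorem ae_comp_neg {n : ℕ} {p : (Fin n → ℝ) → Prop}
    (h : ∀ᵐ x ∂(volume : Measure (Fin n → ℝ)), p x) :
    ∀ᵐ x ∂(volume : Measure (Fin n → ℝ)), p (-x) :=
  (Measure.measurePreserving_neg volume).quasiMeasurePreserving.ae h

theorem integral_Kab_mul {n : ℕ} (a b : ℝ) {f g : (Fin n → ℝ) → ℝ} {x : Fin n → ℝ}
    (h₁ : Integrable (fun v => f (x - v) * g v) volume)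
    (h₂ : Integrable (fun v => f (x + v) * g v) volume)
    (h₃ : Integrable (fun v => f (-x + v) * g v) volume)
    (h₄ : Integrable (fun v => f (-x - v) * g v) volume) :
    ∫ v, Kab n a b f x v * g v =
      (3 * a ^ 2 - b ^ 2) * (∫ v, f (x - v) * g v) +
        (a ^ 2 + b ^ 2) * ((∫ v, f (x + v) * g v) + (∫ v, f (-x + v) * g v) -
          ∫ v, f (-x - v) * g v) := by
  have h₂₃ : Integrable (fun v => f (x + v) * g v + f (-x + v) * g v) volume := h₂.add h₃
  rw [← integral_add h₂ h₃, ← integral_sub h₂₃ h₄, ← integral_const_mul, ← integral_const_mul,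
    ← integral_add (h₁.const_mul _) ((h₂₃.sub' h₄).const_mul _)]
  refine integral_congr_ae (Eventually.of_forall fun v => ?_)
  simp only [Kab]
  ring

theorem integral_sub_mul_comm {n : ℕ} (f g : (Fin n → ℝ) → ℝ) (x : Fin n → ℝ) :
    ∫ v, f (x - v) * g v = ∫ v, g (x - v) * f v := by
  rw [← integral_sub_left_eq_self (fun v => g (x - v) * f v) volume x]
  simp [mul_comm]

theorem integral_add_mul_comm {n : ℕ} (f g : (Fin n → ℝ) → ℝ) (x : Fin n → ℝ) :
    ∫ v, f (x + v) * g v = ∫ v, g (-x + v) * f v := by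
  rw [← integral_add_left_eq_self (fun v => g (-x + v) * f v) x]
  simp [mul_comm]

theorem MeasureTheory.Integrable.add_mul_of_neg_add_mul {n : ℕ} {f g : (Fin n → ℝ) → ℝ} {x : Fin n → ℝ}
    (h : Integrable (fun v => g (-x + v) * f v) volume) :
    Integrable (fun v => f (x + v) * g v) volume := by
  simpa [mul_comm] using h.comp_add_left x

theorem ae_integrable_neg_add_mul {n : ℕ} {f g : (Fin n → ℝ) → ℝ}
    (hf : Integrable f volume) (hg : Integrable g volume) :
    ∀ᵐ x ∂(volume : Measure (Fin n → ℝ)), Integrable (fun v => f (-x + v) * g v) volume := by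
  filter_upwards [ae_integrable_sub_mul hf.comp_neg hg] with x hx
  simpa [sub_eq_neg_add] using hx

theorem stmt5 (n : ℕ) (hn : 1 ≤ n) (a b : ℝ) (ha : a ≠ 0)
    (hab : a ^ 2 + b ^ 2 ≠ 0) (hab1 : a ≠ b) (hab2 : a ≠ -b)
    (f g : (Fin n → ℝ) → ℝ) (hf : Integrable f volume) (hg : Integrable g volume) :
    ∀ᵐ x ∂(volume : Measure (Fin n → ℝ)),
      Hconv n a b f g x = Hconv n a b g f x := by
  filter_upwards [ae_integrable_sub_mul hf hg, ae_comp_neg (ae_integrable_sub_mul hf hg),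
    ae_integrable_sub_mul hg hf, ae_comp_neg (ae_integrable_sub_mul hg hf),
    ae_integrable_neg_add_mul hf hg, ae_integrable_neg_add_mul hg hf]
    with x hfg hfg' hgf hgf' hfg_add hgf_add
  rw [Hconv, Hconv, integral_Kab_mul a b hfg hgf_add.add_mul_of_neg_add_mul hfg_add hfg',
    integral_Kab_mul a b hgf hfg_add.add_mul_of_neg_add_mul hgf_add hgf',
    integral_sub_mul_comm f g x, integral_sub_mul_comm f g (-x),
    integral_add_mul_comm f g x, integral_add_mul_comm g f x]
  ring
end

section
/- There is no multiplicative identity for the ℋ-convolution on L¹(ℝⁿ): there exists no e ∈ L¹(ℝⁿ) such that e ⋆_ℋ f = f almost everywhere on ℝⁿ for every f ∈ L¹(ℝⁿ). -/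
open MeasureTheory Real Filter

/-- The integral of an integrable function over balls shrinking to a null point can be made
arbitrarily small. -/
theorem exists_ball_setIntegral_abs_lt {E : Type*} [MetricSpace E] [MeasurableSpace E]
    [OpensMeasurableSpace E] {μ : Measure E} [NullSingletonClass μ] {e : E → ℝ}
    (he : Integrable e μ) (x : E) {ε : ℝ} (hε : 0 < ε) :
    ∃ r > 0, ∫ v in Metric.ball x r, |e v| ∂μ < ε := by
  have hanti : Antitone fun k : ℕ => Metric.ball x (1 / ((k : ℝ) + 1)) := fun i j hij =>
    Metric.ball_subset_ball (one_div_le_one_div_of_le (by positivity) (by gcongr))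
  have hlim := tendsto_setIntegral_of_antitone (μ := μ) (f := fun v => |e v|)
    (fun _ => Metric.isOpen_ball.measurableSet) hanti
    ⟨0, he.abs.integrableOn⟩
  have hsub : (⋂ k : ℕ, Metric.ball x (1 / ((k : ℝ) + 1))) ⊆ {x} := by
    intro y hy
    rw [Set.mem_singleton_iff, ← dist_le_zero]
    refine ge_of_tendsto' tendsto_one_div_add_atTop_nhds_zero_nat fun k => ?_
    exact (Metric.mem_ball.1 (Set.mem_iInter.1 hy k)).le
  rw [setIntegral_measure_zero _ (measure_mono_null hsub (measure_singleton x))] at hlim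
  obtain ⟨k, hk⟩ := (hlim.eventually (gt_mem_nhds hε)).exists
  exact ⟨_, by positivity, hk⟩

theorem abs_Kab_le (n : ℕ) (a b : ℝ) (f : (Fin n → ℝ) → ℝ) (x v : Fin n → ℝ) :
    |Kab n a b f x v| ≤ (|3 * a ^ 2 - b ^ 2| + |a ^ 2 + b ^ 2|) *
      (|f (x - v)| + |f (x + v)| + |f (-x + v)| + |f (-x - v)|) := by
  have h₁ : |f (x + v) + f (-x + v) - f (-x - v)| ≤
      |f (x + v)| + |f (-x + v)| + |f (-x - v)| :=
    (abs_sub _ _).trans (by gcongr; exact abs_add_le _ _)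
  calc |Kab n a b f x v|
      ≤ |3 * a ^ 2 - b ^ 2| * |f (x - v)| +
        |a ^ 2 + b ^ 2| * |f (x + v) + f (-x + v) - f (-x - v)| := by
        rw [← abs_mul, ← abs_mul]; exact abs_add_le _ _
    _ ≤ |3 * a ^ 2 - b ^ 2| * |f (x - v)| +
        |a ^ 2 + b ^ 2| * (|f (x + v)| + |f (-x + v)| + |f (-x - v)|) := by gcongr
    _ ≤ _ := by
        have : 0 ≤ |3 * a ^ 2 - b ^ 2| * (|f (x + v)| + |f (-x + v)| + |f (-x - v)|) := by
          positivity
        have : 0 ≤ |a ^ 2 + b ^ 2| * |f (x - v)| := by positivity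
        linarith

/-- For `x` in a ball around the origin, the `ℋ`-convolution of `e` with the indicator of that
ball only sees the values of `e` on the ball of twice the radius. -/
theorem abs_integral_Kab_mul_indicator_le (n : ℕ) (a b : ℝ) {e : (Fin n → ℝ) → ℝ}
    (he : Integrable e volume) {r : ℝ} {x : Fin n → ℝ} (hx : x ∈ Metric.ball 0 r) :
    |∫ v, Kab n a b e x v * (Metric.ball (0 : Fin n → ℝ) r).indicator (fun _ => 1) v| ≤
      (|3 * a ^ 2 - b ^ 2| + |a ^ 2 + b ^ 2|) *
        (4 * ∫ v in Metric.ball (0 : Fin n → ℝ) (2 * r), |e v|) := by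
  set M := |3 * a ^ 2 - b ^ 2| + |a ^ 2 + b ^ 2|
  set h := (Metric.ball (0 : Fin n → ℝ) (2 * r)).indicator fun v => |e v| with hh
  have hint : Integrable h volume := he.abs.indicator Metric.isOpen_ball.measurableSet
  have h₀ : ∀ w, 0 ≤ h w := fun w => Set.indicator_nonneg (fun _ _ => abs_nonneg _) w
  have i₁ : Integrable (fun v => h (x - v)) volume := hint.comp_sub_left x
  have i₂ : Integrable (fun v => h (x + v)) volume := hint.comp_add_left x
  have i₃ : Integrable (fun v => h (-x + v)) volume := hint.comp_add_left (-x)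
  have i₄ : Integrable (fun v => h (-x - v)) volume := hint.comp_sub_left (-x)
  have hbound : ∀ v, ‖Kab n a b e x v *
      (Metric.ball (0 : Fin n → ℝ) r).indicator (fun _ => 1) v‖ ≤
      M * (h (x - v) + h (x + v) + h (-x + v) + h (-x - v)) := by
    intro v
    by_cases hv : v ∈ Metric.ball (0 : Fin n → ℝ) r
    · have hx' : ‖x‖ < r := mem_ball_zero_iff.1 hx
      have hv' : ‖v‖ < r := mem_ball_zero_iff.1 hv
      have key : ∀ w : Fin n → ℝ, ‖w‖ ≤ ‖x‖ + ‖v‖ → h w = |e w| := fun w hw =>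
        Set.indicator_of_mem (mem_ball_zero_iff.2 (by linarith)) _
      rw [Set.indicator_of_mem hv, mul_one, Real.norm_eq_abs, key _ (norm_sub_le _ _),
        key _ (norm_add_le _ _), key _ ((norm_add_le _ _).trans_eq (by rw [norm_neg])),
        key _ ((norm_sub_le _ _).trans_eq (by rw [norm_neg]))]
      exact abs_Kab_le n a b e x v
    · rw [Set.indicator_of_notMem hv, mul_zero, norm_zero]
      have := h₀ (x - v)
      have := h₀ (x + v)
      have := h₀ (-x + v)
      have := h₀ (-x - v)
      positivity
  have i₁₂ : Integrable (fun v => h (x - v) + h (x + v)) volume := i₁.add i₂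
  have i₁₂₃ : Integrable (fun v => h (x - v) + h (x + v) + h (-x + v)) volume := i₁₂.add i₃
  refine (norm_integral_le_of_norm_le ((i₁₂₃.add i₄).const_mul M)
    (ae_of_all _ hbound)).trans_eq ?_
  simp only [Pi.add_apply]
  rw [integral_const_mul, integral_add i₁₂₃ i₄, integral_add i₁₂ i₃, integral_add i₁ i₂,
    integral_sub_left_eq_self h, integral_sub_left_eq_self h,
    integral_add_left_eq_self h, integral_add_left_eq_self h, hh,
    integral_indicator Metric.isOpen_ball.measurableSet]
  ring

theorem stmt7 (n : ℕ) (hn : 1 ≤ n) (a b : ℝ) (ha : a ≠ 0)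
    (hab : a ^ 2 + b ^ 2 ≠ 0) (hab1 : a ≠ b) (hab2 : a ≠ -b) :
    ¬ ∃ e : (Fin n → ℝ) → ℝ, Integrable e volume ∧
      ∀ f : (Fin n → ℝ) → ℝ, Integrable f volume →
        ∀ᵐ x ∂(volume : Measure (Fin n → ℝ)), Hconv n a b e f x = f x := by
  rintro ⟨e, he, hid⟩
  have : Nonempty (Fin n) := ⟨⟨0, hn⟩⟩
  set c := 1 / (4 * a * (2 * Real.pi) ^ ((n : ℝ) / 2)) with hc
  set M := |3 * a ^ 2 - b ^ 2| + |a ^ 2 + b ^ 2| with hM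
  obtain ⟨s, hs, hse⟩ := exists_ball_setIntegral_abs_lt he (0 : Fin n → ℝ)
    (show 0 < 1 / (|c| * M * 4 + 1) by positivity)
  have hball : MeasurableSet (Metric.ball (0 : Fin n → ℝ) (s / 2)) :=
    Metric.isOpen_ball.measurableSet
  have hf : Integrable ((Metric.ball (0 : Fin n → ℝ) (s / 2)).indicator fun _ => (1 : ℝ))
      volume :=
    (integrable_indicator_iff hball).2 (integrableOn_const measure_ball_lt_top.ne)
  obtain ⟨x, hx, hxe⟩ : ∃ x ∈ Metric.ball (0 : Fin n → ℝ) (s / 2), Hconv n a b e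
      ((Metric.ball (0 : Fin n → ℝ) (s / 2)).indicator fun _ => 1) x =
      (Metric.ball (0 : Fin n → ℝ) (s / 2)).indicator (fun _ => 1) x := by
    by_contra! hne
    exact (Metric.measure_ball_pos volume (0 : Fin n → ℝ) (half_pos hs)).ne'
      (measure_mono_null hne (ae_iff.1 (hid _ hf)))
  rw [Set.indicator_of_mem hx, Hconv, ← hc] at hxe
  have hle := abs_integral_Kab_mul_indicator_le n a b he hx
  rw [mul_div_cancel₀ s two_ne_zero, ← hM] at hle
  have h₁ := congrArg abs hxe
  rw [abs_mul, abs_one] at h₁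
  have h₂ := mul_le_mul_of_nonneg_left hle (abs_nonneg c)
  rw [lt_div_iff₀ (by positivity)] at hse
  have h₃ : 0 ≤ ∫ v in Metric.ball (0 : Fin n → ℝ) s, |e v| :=
    integral_nonneg fun _ => abs_nonneg _
  nlinarith
end

section
/- Wiener–Lévy invertibility criterion: let g ∈ L¹(ℝⁿ) and suppose 1 + (ℋg)(y) ≠ 0 for all y ∈ ℝⁿ. Then there exists ℓ ∈ L¹(ℝⁿ) such that (ℋℓ)(y) = −(ℋg)(y)/(1 + (ℋg)(y)) for every y ∈ ℝⁿ. -/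
open MeasureTheory Real Filter

noncomputable def Htransform (n : ℕ) (a b : ℝ) (f : (Fin n → ℝ) → ℝ)
    (y : Fin n → ℝ) : ℝ :=
  (2 * Real.pi) ^ (-(n : ℝ) / 2) *
    ∫ x, (a * Real.cos (∑ i, x i * y i) + b * Real.sin (∑ i, x i * y i)) * f x

section Gelfand

variable {A : Type*} [NonUnitalNormedCommRing A] [NormedSpace ℂ A] [IsScalarTower ℂ A A]
  [SMulCommClass ℂ A A]

noncomputable instance : NormedCommRing (WithLp 1 (Unitization ℂ A)) where
  mul_comm x y := WithLp.ofLp_injective 1 (mul_comm (WithLp.ofLp x) (WithLp.ofLp y))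

/-- In a commutative Banach algebra, `g` is quasi-invertible as soon as no character takes the
value `-1` at `g`. -/
lemma exists_quasi_inverse_of_forall_character [CompleteSpace A] (g : A)
    (hg : ∀ φ : A →L[ℂ] ℂ, (∀ f₁ f₂, φ (f₁ * f₂) = φ f₁ * φ f₂) → φ g ≠ -1) :
    ∃ h : A, g + h + g * h = 0 := by
  let ι : A →ₗ[ℂ] WithLp 1 (Unitization ℂ A) :=
    (WithLp.linearEquiv 1 ℂ (Unitization ℂ A)).symm.toLinearMap ∘ₗ Unitization.inrHom ℂ ℂ A
  have hι_norm (f : A) : ‖ι f‖ = ‖f‖ := WithLp.unitization_norm_inr f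
  have hι_mul (f₁ f₂ : A) : ι (f₁ * f₂) = ι f₁ * ι f₂ :=
    WithLp.ofLp_injective 1 (Unitization.inr_mul ℂ f₁ f₂)
  have hu : IsUnit (1 + ι g) := by
    by_contra hu
    obtain ⟨Φ, hΦ⟩ := WeakDual.CharacterSpace.exists_apply_eq_zero hu
    refine hg ((WeakDual.CharacterSpace.toCLM Φ).comp
      (LinearMap.mkContinuous ι 1 fun f ↦ by rw [hι_norm, one_mul])) (fun f₁ f₂ ↦ ?_) ?_
    · change Φ (ι (f₁ * f₂)) = Φ (ι f₁) * Φ (ι f₂)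
      rw [hι_mul, map_mul]
    · change Φ (ι g) = -1
      rw [map_add, map_one] at hΦ
      linear_combination hΦ
  obtain ⟨v, hv⟩ := hu.exists_right_inv
  obtain ⟨w, rfl⟩ := WithLp.toLp_surjective 1 v
  have hw : (1 + (g : Unitization ℂ A)) * w = 1 := congrArg WithLp.ofLp hv
  have h₁ : w.fst = 1 := by simpa using congrArg (fun x ↦ x.fst) hw
  have h₂ : w.snd + (g + g * w.snd) = 0 := by
    simpa [h₁, add_mul] using congrArg (fun x ↦ x.snd) hw
  exact ⟨w.snd, by rw [← h₂]; abel⟩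

end Gelfand

section Convolution

set_option linter.unusedSectionVars false

variable {G : Type*} [AddCommGroup G] [TopologicalSpace G] [IsTopologicalAddGroup G]
  [LocallyCompactSpace G] [SecondCountableTopology G] [MeasurableSpace G] [BorelSpace G]
  {μ : Measure G} [μ.IsAddHaarMeasure]
  {F : Type*} [NormedAddCommGroup F] [NormedSpace ℂ F]

/-- Translation on `L¹`: `(translateL1 t f) x = f (x - t)`. -/
noncomputable def translateL1 (t : G) (f : Lp ℂ 1 μ) : Lp ℂ 1 μ :=
  Lp.compMeasurePreserving (fun x ↦ x - t) (measurePreserving_sub_right μ t) f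

lemma coeFn_translateL1 (t : G) (f : Lp ℂ 1 μ) :
    translateL1 t f =ᵐ[μ] fun x ↦ f (x - t) :=
  Lp.coeFn_compMeasurePreserving f (measurePreserving_sub_right μ t)

lemma norm_translateL1 (t : G) (f : Lp ℂ 1 μ) : ‖translateL1 t f‖ = ‖f‖ :=
  Lp.norm_compMeasurePreserving f (measurePreserving_sub_right μ t)

lemma translateL1_translateL1 (s t : G) (f : Lp ℂ 1 μ) :
    translateL1 s (translateL1 t f) = translateL1 (t + s) f := by
  refine Lp.ext ?_
  filter_upwards [coeFn_translateL1 s (translateL1 t f), coeFn_translateL1 (t + s) f,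
    (measurePreserving_sub_right μ s).quasiMeasurePreserving.ae (coeFn_translateL1 t f)]
    with x h₁ h₂ h₃
  rw [h₁, h₂, h₃]
  congr 1
  abel

lemma translateL1_zero (f : Lp ℂ 1 μ) : translateL1 0 f = f := by
  refine Lp.ext ?_
  filter_upwards [coeFn_translateL1 0 f] with x h
  rw [h, sub_zero]

lemma continuous_translateL1 (f : Lp ℂ 1 μ) : Continuous fun t ↦ translateL1 t f := by
  let c : C(G, C(G, G)) := ContinuousMap.curry ⟨fun p : G × G ↦ p.2 - p.1, by fun_prop⟩
  exact (continuous_const (y := f)).compMeasurePreservingLp c.continuous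
    (fun t ↦ measurePreserving_sub_right μ t) ENNReal.one_ne_top

lemma integrable_L1_smul {c : G → F} {C : ℝ} (hc : AEStronglyMeasurable c μ)
    (hC : ∀ t, ‖c t‖ ≤ C) (f : Lp ℂ 1 μ) : Integrable (fun t ↦ f t • c t) μ :=
  (L1.integrable_coeFn f).smul_bdd C hc (.of_forall hC)

lemma integrable_smul_translateL1 (f g : Lp ℂ 1 μ) :
    Integrable (fun t ↦ f t • translateL1 t g) μ :=
  integrable_L1_smul (continuous_translateL1 g).aestronglyMeasurable
    (fun t ↦ (norm_translateL1 t g).le) f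

lemma integral_translateL1_smul (s : G) (f : Lp ℂ 1 μ) (c : G → F) :
    ∫ t, translateL1 s f t • c t ∂μ = ∫ t, f t • c (t + s) ∂μ := by
  rw [← integral_sub_right_eq_self (fun t ↦ f t • c (t + s)) s]
  refine integral_congr_ae ?_
  filter_upwards [coeFn_translateL1 s f] with t ht
  rw [ht, sub_add_cancel]

/-- The continuous linear map `f ↦ ∫ f c` on `L¹`, for a bounded measurable `c`. -/
noncomputable def pairL1 {c : G → F} {C : ℝ} (hc : AEStronglyMeasurable c μ)
    (hC : ∀ t, ‖c t‖ ≤ C) : Lp ℂ 1 μ →L[ℂ] F :=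
  LinearMap.mkContinuous
    { toFun f := ∫ t, f t • c t ∂μ
      map_add' f g := by
        rw [← integral_add (integrable_L1_smul hc hC f) (integrable_L1_smul hc hC g)]
        refine integral_congr_ae ?_
        filter_upwards [Lp.coeFn_add f g] with t ht
        rw [ht, Pi.add_apply, add_smul]
      map_smul' k f := by
        rw [RingHom.id_apply, ← integral_smul]
        refine integral_congr_ae ?_
        filter_upwards [Lp.coeFn_smul k f] with t ht
        rw [ht, Pi.smul_apply, smul_assoc] } C fun f ↦ by
    rw [L1.norm_eq_integral_norm, ← integral_const_mul]
    refine norm_integral_le_of_norm_le ((L1.integrable_coeFn f).norm.const_mul C) (.of_forall ?_)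
    intro t
    rw [norm_smul, mul_comm]
    gcongr
    exact hC t

lemma pairL1_apply {c : G → F} {C : ℝ} (hc : AEStronglyMeasurable c μ)
    (hC : ∀ t, ‖c t‖ ≤ C) (f : Lp ℂ 1 μ) : pairL1 hc hC f = ∫ t, f t • c t ∂μ := rfl

/-- Convolution on `L¹`, as the integral of the translates of the second factor weighted by the
first one. -/
noncomputable def convL1 (f g : Lp ℂ 1 μ) : Lp ℂ 1 μ := ∫ t, f t • translateL1 t g ∂μ

lemma convL1_eq_pairL1 (f g : Lp ℂ 1 μ) :
    convL1 f g = pairL1 (continuous_translateL1 g).aestronglyMeasurable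
      (fun t ↦ (norm_translateL1 t g).le) f := rfl

lemma map_convL1 [CompleteSpace F] (T : Lp ℂ 1 μ →L[ℂ] F) (f g : Lp ℂ 1 μ) :
    T (convL1 f g) = ∫ t, f t • T (translateL1 t g) ∂μ := by
  rw [convL1, ← T.integral_comp_comm (integrable_smul_translateL1 f g)]
  simp only [map_smul]

lemma convL1_translateL1 (s : G) (f g : Lp ℂ 1 μ) :
    convL1 (translateL1 s f) g = convL1 f (translateL1 s g) := by
  refine (integral_translateL1_smul s f fun t ↦ translateL1 t g).trans ?_
  simp only [convL1, translateL1_translateL1, add_comm s]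
  rfl

lemma translateL1_convL1 (s : G) (f g : Lp ℂ 1 μ) :
    translateL1 s (convL1 f g) = convL1 f (translateL1 s g) := by
  have h := map_convL1 (Lp.compMeasurePreservingₗᵢ ℂ _
    (measurePreserving_sub_right μ s)).toContinuousLinearMap f g
  refine h.trans ?_
  refine integral_congr_ae (.of_forall fun t ↦ ?_)
  change f t • translateL1 s (translateL1 t g) = f t • translateL1 t (translateL1 s g)
  rw [translateL1_translateL1, translateL1_translateL1, add_comm]

lemma convL1_assoc (f g h : Lp ℂ 1 μ) : convL1 (convL1 f g) h = convL1 f (convL1 g h) := by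
  rw [convL1_eq_pairL1 _ h, map_convL1]
  simp only [← convL1_eq_pairL1, convL1_translateL1, ← translateL1_convL1]
  rfl

lemma pairL1_convL1 {c : G → ℂ} {C : ℝ} (hc : AEStronglyMeasurable c μ)
    (hC : ∀ t, ‖c t‖ ≤ C) (f g : Lp ℂ 1 μ) :
    pairL1 hc hC (convL1 f g) = ∫ t, f t * ∫ u, g u * c (u + t) ∂μ ∂μ := by
  rw [map_convL1]
  congr 1 with t
  rw [pairL1_apply, integral_translateL1_smul t g c]
  simp only [smul_eq_mul]

lemma convL1_comm (f g : Lp ℂ 1 μ) : convL1 f g = convL1 g f := by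
  refine Lp.ext (Integrable.ae_eq_of_forall_setIntegral_eq _ _ (L1.integrable_coeFn _)
    (L1.integrable_coeFn _) fun s hs _ ↦ ?_)
  have hm : Measurable (s.indicator (1 : G → ℂ)) := measurable_one.indicator hs
  have hC (t : G) : ‖s.indicator (1 : G → ℂ) t‖ ≤ 1 := by
    simpa using norm_indicator_le_norm_self (1 : G → ℂ) t
  have key (h : Lp ℂ 1 μ) : ∫ x in s, h x ∂μ = pairL1 hm.aestronglyMeasurable hC h := by
    rw [pairL1_apply, ← integral_indicator hs]
    congr 1 with x
    by_cases hx : x ∈ s <;> simp [hx]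
  rw [key, key, pairL1_convL1, pairL1_convL1]
  simp only [← integral_const_mul]
  rw [integral_integral_swap]
  · simp only [add_comm, mul_left_comm]
  · have : Integrable (fun p : G × G ↦ (f p.1 * g p.2) * s.indicator (1 : G → ℂ) (p.2 + p.1))
        (μ.prod μ) :=
      ((L1.integrable_coeFn f).mul_prod (L1.integrable_coeFn g)).mul_bdd (c := 1)
        (hm.comp (measurable_snd.add measurable_fst)).aestronglyMeasurable (.of_forall fun p ↦ hC _)
    simpa only [Function.uncurry_def, mul_assoc] using this

lemma norm_convL1_le (f g : Lp ℂ 1 μ) : ‖convL1 f g‖ ≤ ‖f‖ * ‖g‖ := by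
  rw [convL1_eq_pairL1, mul_comm]
  exact (pairL1 _ _).le_of_opNorm_le (LinearMap.mkContinuous_norm_le _ (norm_nonneg g) _) f

variable (μ) in
/-- `L¹(μ)`, regarded as a Banach algebra under convolution. -/
def ConvAlgebra : Type _ := Lp ℂ 1 μ

namespace ConvAlgebra

noncomputable instance : NormedAddCommGroup (ConvAlgebra μ) :=
  inferInstanceAs (NormedAddCommGroup (Lp ℂ 1 μ))

noncomputable instance : NormedSpace ℂ (ConvAlgebra μ) :=
  inferInstanceAs (NormedSpace ℂ (Lp ℂ 1 μ))

instance : CompleteSpace (ConvAlgebra μ) :=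
  inferInstanceAs (CompleteSpace (Lp ℂ 1 μ))

noncomputable instance : Mul (ConvAlgebra μ) := ⟨fun f g ↦ convL1 (μ := μ) f g⟩

protected lemma add_mul (f g h : ConvAlgebra μ) : (f + g) * h = f * h + g * h :=
  map_add (pairL1 (continuous_translateL1 (μ := μ) h).aestronglyMeasurable
    (fun t ↦ (norm_translateL1 t h).le)) f g

protected lemma mul_comm (f g : ConvAlgebra μ) : f * g = g * f := convL1_comm f g

noncomputable instance : NonUnitalNormedCommRing (ConvAlgebra μ) where
  __ := (inferInstance : NormedAddCommGroup (ConvAlgebra μ))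
  left_distrib f g h := by
    simp only [ConvAlgebra.mul_comm f, ConvAlgebra.add_mul]
  right_distrib := ConvAlgebra.add_mul
  zero_mul f := by simpa using ConvAlgebra.add_mul 0 0 f
  mul_zero f := by simpa [ConvAlgebra.mul_comm f] using ConvAlgebra.add_mul 0 0 f
  mul_assoc f g h := convL1_assoc f g h
  mul_comm := ConvAlgebra.mul_comm
  norm_mul_le f g := norm_convL1_le (μ := μ) f g

instance : IsScalarTower ℂ (ConvAlgebra μ) (ConvAlgebra μ) :=
  ⟨fun c f g ↦ map_smul (pairL1 (continuous_translateL1 (μ := μ) g).aestronglyMeasurable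
    (fun t ↦ (norm_translateL1 t g).le)) c f⟩

instance : SMulCommClass ℂ (ConvAlgebra μ) (ConvAlgebra μ) :=
  ⟨fun c f g ↦ by
    simp only [smul_eq_mul, mul_comm f]
    exact (smul_mul_assoc c g f).symm⟩

end ConvAlgebra

lemma exists_convL1_quasi_inverse (g : Lp ℂ 1 μ)
    (hg : ∀ φ : Lp ℂ 1 μ →L[ℂ] ℂ, (∀ f₁ f₂, φ (convL1 f₁ f₂) = φ f₁ * φ f₂) → φ g ≠ -1) :
    ∃ h : Lp ℂ 1 μ, g + h + convL1 g h = 0 :=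
  exists_quasi_inverse_of_forall_character (A := ConvAlgebra μ) g hg

/-- Characters of the convolution algebra are given by integration against bounded continuous
characters of the group. -/
lemma exists_character_of_map_convL1 (φ : Lp ℂ 1 μ →L[ℂ] ℂ)
    (hφ : ∀ f₁ f₂, φ (convL1 f₁ f₂) = φ f₁ * φ f₂) {g : Lp ℂ 1 μ} (hg : φ g ≠ 0) :
    ∃ χ : G → ℂ, Continuous χ ∧ (∀ s t, χ (s + t) = χ s * χ t) ∧ χ 0 = 1 ∧
      (∃ C, ∀ t, ‖χ t‖ ≤ C) ∧ ∀ f : Lp ℂ 1 μ, φ f = ∫ t, f t * χ t ∂μ := by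
  have hshift (s : G) (f : Lp ℂ 1 μ) : φ (translateL1 s f) = φ f * (φ (translateL1 s g) / φ g) := by
    rw [mul_div_assoc', eq_div_iff hg, ← hφ, ← hφ, convL1_translateL1]
  refine ⟨fun t ↦ φ (translateL1 t g) / φ g,
    (φ.continuous.comp (continuous_translateL1 g)).div_const _, fun s t ↦ ?_, ?_,
    ⟨‖φ‖ * ‖g‖ / ‖φ g‖, fun t ↦ ?_⟩, fun f ↦ ?_⟩
  · simp only
    rw [add_comm, ← translateL1_translateL1, hshift, mul_div_right_comm,
      mul_comm]
  · simp only [translateL1_zero, div_self hg]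
  · rw [norm_div]
    gcongr
    exact (φ.le_opNorm _).trans_eq (by rw [norm_translateL1])
  · have h := map_convL1 φ f g
    rw [hφ] at h
    rw [eq_div_of_mul_eq hg h, ← integral_div]
    simp only [smul_eq_mul, mul_div_assoc]

lemma integral_convL1_mul_character {χ : G → ℂ} (hχ : Continuous χ)
    (hadd : ∀ s t, χ (s + t) = χ s * χ t) {C : ℝ} (hC : ∀ t, ‖χ t‖ ≤ C) (f g : Lp ℂ 1 μ) :
    ∫ t, convL1 f g t * χ t ∂μ = (∫ t, f t * χ t ∂μ) * ∫ t, g t * χ t ∂μ := by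
  refine (pairL1_convL1 hχ.aestronglyMeasurable hC f g).trans ?_
  rw [← integral_mul_const]
  congr 1 with t
  simp only [hadd, ← mul_assoc, integral_mul_const]
  ring

end Convolution


/-- A continuous multiplicative character of the additive group `ℝ` is an exponential. -/
lemma exists_eq_exp_mul_of_continuous {χ : ℝ → ℂ} (hχ : Continuous χ)
    (hadd : ∀ s t, χ (s + t) = χ s * χ t) (h0 : χ 0 = 1) :
    ∃ c : ℂ, ∀ x : ℝ, χ x = Complex.exp (x * c) := by
  set P : ℝ → ℂ := fun x ↦ ∫ t in (0 : ℝ)..x, χ t with hP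
  have hP' (x : ℝ) : HasDerivAt P (χ x) x := hχ.integral_hasStrictDerivAt 0 x |>.hasDerivAt
  obtain ⟨δ, hδ⟩ : ∃ δ, P δ ≠ 0 := by
    by_contra! h
    have h1 := hP' 0
    rw [funext h, h0] at h1
    exact zero_ne_one ((hasDerivAt_const (0 : ℝ) (0 : ℂ)).unique h1)
  have hχP (x : ℝ) : χ x = (P (x + δ) - P x) / P δ := by
    rw [eq_div_iff hδ, hP]
    simp only
    rw [intervalIntegral.integral_interval_sub_left (hχ.intervalIntegrable _ _)
      (hχ.intervalIntegrable _ _), ← intervalIntegral.integral_const_mul]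
    simp only [← hadd]
    rw [intervalIntegral.integral_comp_add_left, add_zero]
  set c : ℂ := (χ δ - 1) / P δ with hc
  have hχ' (x : ℝ) : HasDerivAt χ (χ x * c) x := by
    have h1 : HasDerivAt (fun x ↦ (P (x + δ) - P x) / P δ) ((χ (x + δ) - χ x) / P δ) x :=
      (((hP' (x + δ)).comp_add_const x δ).sub (hP' x)).div_const _
    rw [← funext hχP] at h1
    convert h1 using 1
    rw [hadd, hc]
    ring
  have hE (x : ℝ) : HasDerivAt (fun x : ℝ ↦ Complex.exp (-(x * c)))
      (Complex.exp (-(x * c)) * -c) x := by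
    simpa using ((Complex.ofRealCLM.hasDerivAt (x := x)).mul_const c).neg.cexp
  have hconst (x : ℝ) : χ x * Complex.exp (-(x * c)) = 1 := by
    have hd (y : ℝ) : HasDerivAt (fun y : ℝ ↦ χ y * Complex.exp (-(y * c))) 0 y := by
      refine ((hχ' y).mul (hE y)).congr_deriv ?_
      ring
    have := is_const_of_deriv_eq_zero (fun y ↦ (hd y).differentiableAt) (fun y ↦ (hd y).deriv) x 0
    simpa [h0] using this
  refine ⟨c, fun x ↦ ?_⟩
  have h := hconst x
  rw [Complex.exp_neg] at h
  exact eq_of_mul_inv_eq_one h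

lemma exists_eq_exp_I_mul_of_bounded {χ : ℝ → ℂ} (hχ : Continuous χ)
    (hadd : ∀ s t, χ (s + t) = χ s * χ t) (h0 : χ 0 = 1) {C : ℝ} (hC : ∀ t, ‖χ t‖ ≤ C) :
    ∃ y : ℝ, ∀ x : ℝ, χ x = Complex.exp ((x * y : ℝ) * Complex.I) := by
  obtain ⟨c, hc⟩ := exists_eq_exp_mul_of_continuous hχ hadd h0
  have hre : c.re = 0 := by
    by_contra hre
    have h := hC (C / c.re)
    rw [hc, Complex.norm_exp, Complex.re_ofReal_mul, div_mul_cancel₀ _ hre] at h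
    linarith [Real.add_one_le_exp C]
  refine ⟨c.im, fun x ↦ ?_⟩
  rw [hc]
  congr 1
  apply Complex.ext <;> simp [hre]

/-- Bounded continuous characters of `ℝⁿ` are the usual exponentials. -/
lemma exists_eq_exp_I_dotProduct_of_bounded {ι : Type*} [Fintype ι] {χ : (ι → ℝ) → ℂ}
    (hχ : Continuous χ) (hadd : ∀ s t, χ (s + t) = χ s * χ t) (h0 : χ 0 = 1) {C : ℝ}
    (hC : ∀ t, ‖χ t‖ ≤ C) :
    ∃ y : ι → ℝ, ∀ x, χ x = Complex.exp ((∑ i, x i * y i : ℝ) * Complex.I) := by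
  classical
  have hone (i : ι) : ∃ y : ℝ, ∀ x : ℝ, χ (Pi.single i x) = Complex.exp ((x * y : ℝ) * Complex.I) :=
    exists_eq_exp_I_mul_of_bounded (χ := fun x ↦ χ (Pi.single i x))
      (hχ.comp (continuous_single (A := fun _ : ι ↦ ℝ) i)) (fun s t ↦ by rw [Pi.single_add, hadd])
      (by rw [Pi.single_zero, h0]) (fun t ↦ hC _)
  choose y hy using hone
  refine ⟨y, fun x ↦ ?_⟩
  have hsum (s : Finset ι) (v : ι → ι → ℝ) : χ (∑ i ∈ s, v i) = ∏ i ∈ s, χ (v i) := by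
    induction s using Finset.induction_on with
    | empty => simp [h0]
    | insert i s hi ih => rw [Finset.sum_insert hi, Finset.prod_insert hi, hadd, ih]
  conv_lhs => rw [← Finset.univ_sum_single x, hsum]
  rw [Complex.ofReal_sum, Finset.sum_mul, Complex.exp_sum]
  exact Finset.prod_congr rfl fun i _ ↦ hy i (x i)

section Wiener

variable {ι : Type*} [Fintype ι]

/-- **Wiener's theorem** for `ℂ ⊕ L¹(ℝⁿ)`: if `1 + ĝ` does not vanish, then
`(1 + ĝ)(1 + ĥ) = 1` for some `h` in `L¹`. -/
theorem exists_integrable_fourier_quasi_inverse {g : (ι → ℝ) → ℂ} (hg : Integrable g)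
    (hne : ∀ y : ι → ℝ,
      1 + ∫ x, g x * Complex.exp ((∑ i, x i * y i : ℝ) * Complex.I) ≠ 0) :
    ∃ h : (ι → ℝ) → ℂ, Integrable h ∧ ∀ y : ι → ℝ,
      ∫ x, h x * Complex.exp ((∑ i, x i * y i : ℝ) * Complex.I) =
        -(∫ x, g x * Complex.exp ((∑ i, x i * y i : ℝ) * Complex.I)) /
          (1 + ∫ x, g x * Complex.exp ((∑ i, x i * y i : ℝ) * Complex.I)) := by
  let e (y x : ι → ℝ) : ℂ := Complex.exp ((∑ i, x i * y i : ℝ) * Complex.I)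
  have he (y : ι → ℝ) : Continuous (e y) := by fun_prop
  have hC (y x : ι → ℝ) : ‖e y x‖ ≤ 1 := (Complex.norm_exp_ofReal_mul_I _).le
  have hadd (y s t : ι → ℝ) : e y (s + t) = e y s * e y t := by
    simp only [e, ← Complex.exp_add, ← add_mul, ← Complex.ofReal_add, Pi.add_apply,
      ← Finset.sum_add_distrib]
  have htoL1 (y : ι → ℝ) : ∫ x, hg.toL1 g x * e y x = ∫ x, g x * e y x := by
    refine integral_congr_ae ?_
    filter_upwards [hg.coeFn_toL1] with x hx
    rw [hx]
  obtain ⟨h, hh⟩ := exists_convL1_quasi_inverse (hg.toL1 g) fun φ hφ hφg ↦ by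
    obtain ⟨χ, hχ, hχadd, hχ0, ⟨C, hχC⟩, hφχ⟩ :=
      exists_character_of_map_convL1 φ hφ (g := hg.toL1 g) (by rw [hφg]; norm_num)
    obtain ⟨y, hy⟩ := exists_eq_exp_I_dotProduct_of_bounded hχ hχadd hχ0 hχC
    refine hne y ?_
    change 1 + ∫ x, g x * e y x = 0
    have hφy := hφχ (hg.toL1 g)
    rw [show χ = e y from funext hy, htoL1, hφg] at hφy
    rw [← hφy, add_neg_cancel]
  refine ⟨h, L1.integrable_coeFn h, fun y ↦ ?_⟩
  rw [eq_div_iff (hne y)]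
  change (∫ x, h x * e y x) * (1 + ∫ x, g x * e y x) = -∫ x, g x * e y x
  have key := congrArg (pairL1 (μ := volume) (he y).aestronglyMeasurable (hC y)) hh
  simp only [map_add, map_zero, pairL1_apply, smul_eq_mul,
    integral_convL1_mul_character (he y) (hadd y) (hC y), htoL1] at key
  linear_combination key

end Wiener

section Htransform

variable {n : ℕ}

lemma integrable_mul_cos {f : (Fin n → ℝ) → ℝ} (hf : Integrable f) (y : Fin n → ℝ) :
    Integrable fun x ↦ f x * Real.cos (∑ i, x i * y i) :=
  hf.mul_bdd (c := 1) (by fun_prop : Continuous _).aestronglyMeasurable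
    (.of_forall fun _ ↦ Real.abs_cos_le_one _)

lemma integrable_mul_sin {f : (Fin n → ℝ) → ℝ} (hf : Integrable f) (y : Fin n → ℝ) :
    Integrable fun x ↦ f x * Real.sin (∑ i, x i * y i) :=
  hf.mul_bdd (c := 1) (by fun_prop : Continuous _).aestronglyMeasurable
    (.of_forall fun _ ↦ Real.abs_sin_le_one _)

lemma Htransform_eq {f : (Fin n → ℝ) → ℝ} (hf : Integrable f) (a b : ℝ) (y : Fin n → ℝ) :
    Htransform n a b f y = (2 * π) ^ (-(n : ℝ) / 2) *
      (a * (∫ x, f x * Real.cos (∑ i, x i * y i)) +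
        b * ∫ x, f x * Real.sin (∑ i, x i * y i)) := by
  rw [Htransform, ← integral_const_mul a, ← integral_const_mul b, ← integral_add
    ((integrable_mul_cos hf y).const_mul a) ((integrable_mul_sin hf y).const_mul b)]
  congr 2 with x
  ring

lemma integral_mul_exp_I {p q : (Fin n → ℝ) → ℝ} (hp : Integrable p) (hq : Integrable q)
    (y : Fin n → ℝ) :
    ∫ x, (p x + q x * Complex.I : ℂ) * Complex.exp ((∑ i, x i * y i : ℝ) * Complex.I) =
      ((∫ x, p x * Real.cos (∑ i, x i * y i)) - ∫ x, q x * Real.sin (∑ i, x i * y i) : ℝ) +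
      ((∫ x, p x * Real.sin (∑ i, x i * y i)) + ∫ x, q x * Real.cos (∑ i, x i * y i) : ℝ) *
        Complex.I := by
  rw [← integral_sub (integrable_mul_cos hp y) (integrable_mul_sin hq y),
    ← integral_add (integrable_mul_sin hp y) (integrable_mul_cos hq y), ← integral_complex_ofReal,
    ← integral_complex_ofReal, ← integral_mul_const, ← integral_add]
  · congr 1 with x
    rw [Complex.exp_mul_I, ← Complex.ofReal_cos, ← Complex.ofReal_sin]
    simp only [Complex.ofReal_sub, Complex.ofReal_add, Complex.ofReal_mul]
    linear_combination (q x * Real.sin (∑ i, x i * y i) : ℂ) * Complex.I_mul_I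
  · exact ((integrable_mul_cos hp y).sub (integrable_mul_sin hq y)).ofReal
  · exact ((integrable_mul_sin hp y).add (integrable_mul_cos hq y)).ofReal.mul_const _

lemma integral_comp_neg_mul_cos (f : (Fin n → ℝ) → ℝ) (y : Fin n → ℝ) :
    ∫ x, f (-x) * Real.cos (∑ i, x i * y i) = ∫ x, f x * Real.cos (∑ i, x i * y i) := by
  rw [← integral_neg_eq_self]
  simp

lemma integral_comp_neg_mul_sin (f : (Fin n → ℝ) → ℝ) (y : Fin n → ℝ) :
    ∫ x, f (-x) * Real.sin (∑ i, x i * y i) = -∫ x, f x * Real.sin (∑ i, x i * y i) := by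
  rw [← integral_neg_eq_self, ← integral_neg]
  simp

lemma integral_lincomb_mul_cos {p : (Fin n → ℝ) → ℝ} (hp : Integrable p) (s t : ℝ)
    (y : Fin n → ℝ) :
    ∫ x, (s * p x + t * p (-x)) * Real.cos (∑ i, x i * y i) =
      (s + t) * ∫ x, p x * Real.cos (∑ i, x i * y i) := by
  simp only [add_mul, mul_assoc]
  rw [integral_add ((integrable_mul_cos hp y).const_mul s)
    ((integrable_mul_cos hp.comp_neg y).const_mul t), integral_const_mul, integral_const_mul,
    integral_comp_neg_mul_cos]

lemma integral_lincomb_mul_sin {p : (Fin n → ℝ) → ℝ} (hp : Integrable p) (s t : ℝ)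
    (y : Fin n → ℝ) :
    ∫ x, (s * p x + t * p (-x)) * Real.sin (∑ i, x i * y i) =
      (s - t) * ∫ x, p x * Real.sin (∑ i, x i * y i) := by
  simp only [add_mul, mul_assoc]
  rw [integral_add ((integrable_mul_sin hp y).const_mul s)
    ((integrable_mul_sin hp.comp_neg y).const_mul t), integral_const_mul, integral_const_mul,
    integral_comp_neg_mul_sin]
  ring

/-- Every `ℋ`-transform of an integrable function is the Fourier transform of one. -/
lemma exists_fourier_eq_Htransform {f : (Fin n → ℝ) → ℝ} (hf : Integrable f) (a b : ℝ) :
    ∃ g : (Fin n → ℝ) → ℂ, Integrable g ∧ ∀ y,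
      ∫ x, g x * Complex.exp ((∑ i, x i * y i : ℝ) * Complex.I) = Htransform n a b f y := by
  set c : ℝ := (2 * π) ^ (-(n : ℝ) / 2) with hc
  have hlin (s t : ℝ) : Integrable fun x ↦ s * f x + t * f (-x) :=
    (hf.const_mul s).add (hf.comp_neg.const_mul t)
  refine ⟨fun x ↦ ((c * a / 2 * f x + c * a / 2 * f (-x) : ℝ) : ℂ) +
    ((-(c * b / 2) * f x + c * b / 2 * f (-x) : ℝ) : ℂ) * Complex.I,
    (hlin _ _).ofReal.add ((hlin _ _).ofReal.mul_const _), fun y ↦ ?_⟩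
  rw [integral_mul_exp_I (hlin _ _) (hlin _ _), integral_lincomb_mul_cos hf,
    integral_lincomb_mul_cos hf, integral_lincomb_mul_sin hf, integral_lincomb_mul_sin hf,
    Htransform_eq hf, ← hc]
  push_cast
  ring

/-- A real-valued Fourier transform of an integrable function is an `ℋ`-transform, provided it is
even in the degenerate case `b = 0`. -/
lemma exists_Htransform_eq_fourier {a b : ℝ} (ha : a ≠ 0) {h : (Fin n → ℝ) → ℂ}
    (hh : Integrable h) {v : (Fin n → ℝ) → ℝ}
    (hv : ∀ y, ∫ x, h x * Complex.exp ((∑ i, x i * y i : ℝ) * Complex.I) = v y)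
    (heven : b = 0 → ∀ y, v (-y) = v y) :
    ∃ ℓ : (Fin n → ℝ) → ℝ, Integrable ℓ ∧ ∀ y, Htransform n a b ℓ y = v y := by
  set c : ℝ := (2 * π) ^ (-(n : ℝ) / 2) with hc
  have hc0 : c ≠ 0 := (Real.rpow_pos_of_pos (by positivity) _).ne'
  set p : (Fin n → ℝ) → ℝ := fun x ↦ (h x).re
  set q : (Fin n → ℝ) → ℝ := fun x ↦ (h x).im
  have hp : Integrable p := hh.re
  have hq : Integrable q := hh.im
  have hvpq (y : Fin n → ℝ) : v y =
      (∫ x, p x * Real.cos (∑ i, x i * y i)) - ∫ x, q x * Real.sin (∑ i, x i * y i) := by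
    have h1 := integral_mul_exp_I hp hq y
    simp only [p, q, Complex.re_add_im, hv] at h1
    simpa using congrArg Complex.re h1
  have hlin {f : (Fin n → ℝ) → ℝ} (hf : Integrable f) (s t : ℝ) :
      Integrable fun x ↦ s * f x + t * f (-x) :=
    (hf.const_mul s).add (hf.comp_neg.const_mul t)
  have hP := hlin hp (1 / (2 * a * c)) (1 / (2 * a * c))
  have hQ := hlin hq (-(1 / (2 * b * c))) (1 / (2 * b * c))
  refine ⟨_, hP.add hQ, fun y ↦ ?_⟩
  rw [Htransform_eq (hP.add hQ), ← hc]
  simp only [Pi.add_apply, add_mul (_ + _)]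
  rw [integral_add (integrable_mul_cos hP y) (integrable_mul_cos hQ y),
    integral_add (integrable_mul_sin hP y) (integrable_mul_sin hQ y),
    integral_lincomb_mul_cos hp, integral_lincomb_mul_cos hq, integral_lincomb_mul_sin hp,
    integral_lincomb_mul_sin hq]
  by_cases hb : b = 0
  · have hneg := heven hb y
    have hy := hvpq y
    rw [hvpq (-y)] at hneg
    simp only [Pi.neg_apply, mul_neg, Finset.sum_neg_distrib, Real.cos_neg, Real.sin_neg,
      integral_neg] at hneg
    rw [hb]
    simp only [mul_zero, zero_mul, div_zero, neg_zero, add_zero]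
    field_simp
    linarith
  · rw [hvpq]
    field_simp
    ring

end Htransform

theorem stmt10 (n : ℕ) (hn : 1 ≤ n) (a b : ℝ) (ha : a ≠ 0)
    (hab : a ^ 2 + b ^ 2 ≠ 0) (hab1 : a ≠ b) (hab2 : a ≠ -b)
    (g : (Fin n → ℝ) → ℝ) (hg : Integrable g volume)
    (hnv : ∀ y, 1 + Htransform n a b g y ≠ 0) :
    ∃ ℓ : (Fin n → ℝ) → ℝ, Integrable ℓ volume ∧
      ∀ y, Htransform n a b ℓ y =
        -(Htransform n a b g y) / (1 + Htransform n a b g y) := by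
  obtain ⟨G, hG, hGg⟩ := exists_fourier_eq_Htransform hg a b
  obtain ⟨h, hh, hhG⟩ := exists_integrable_fourier_quasi_inverse hG fun y ↦ by
    rw [hGg]
    exact_mod_cast hnv y
  refine exists_Htransform_eq_fourier ha hh (fun y ↦ ?_) fun hb y ↦ ?_
  · rw [hhG, hGg]
    push_cast
    rfl
  · simp [Htransform, hb]
end

section
/- Convolution representation of the heat kernel action: let κ > 0, t > 0, φ ∈ L¹(ℝ), and define g_t(ξ) = (κt)^{−1/2} e^{−ξ²/(4κt)}. Set u := (1/(a√2)) · (g_t ⋆_ℋ φ). Then u ∈ L¹(ℝ) and (ℋu)(y) = e^{−κt y²} · (ℋφ)(y) for every y ∈ ℝ. -/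
open MeasureTheory Real Filter

noncomputable def Htransform1 (a b : ℝ) (f : ℝ → ℝ) (y : ℝ) : ℝ :=
  (2 * Real.pi) ^ (-(1 : ℝ) / 2) *
    ∫ x, (a * Real.cos (x * y) + b * Real.sin (x * y)) * f x

noncomputable def Kab1 (a b : ℝ) (f : ℝ → ℝ) (x v : ℝ) : ℝ :=
  (3 * a ^ 2 - b ^ 2) * f (x - v) +
    (a ^ 2 + b ^ 2) * (f (x + v) + f (-x + v) - f (-x - v))

noncomputable def Hconv1 (a b : ℝ) (f g : ℝ → ℝ) (x : ℝ) : ℝ :=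
  (1 / (4 * a * (2 * Real.pi) ^ ((1 : ℝ) / 2))) * ∫ v, Kab1 a b f x v * g v

/-- Convolution with an even function reduces to the ordinary convolution. -/
theorem Hconv1_of_even (a b : ℝ) {f : ℝ → ℝ} (hf : ∀ x, f (-x) = f x) (g : ℝ → ℝ) (x : ℝ) :
    Hconv1 a b f g x = (a / (2 * Real.pi) ^ ((1 : ℝ) / 2)) * ∫ v, g v * f (x - v) := by
  have h : ∀ v, Kab1 a b f x v * g v = (4 * a ^ 2) * (g v * f (x - v)) := by
    intro v
    have h1 : f (-x + v) = f (x - v) := by rw [← hf (x - v)]; ring_nf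
    have h2 : f (-x - v) = f (x + v) := by rw [← hf (x + v)]; ring_nf
    rw [Kab1, h1, h2]
    ring
  rw [Hconv1, integral_congr_ae (Eventually.of_forall h), integral_const_mul]
  by_cases ha : a = 0
  · simp [ha]
  have : (2 * Real.pi) ^ ((1 : ℝ) / 2) ≠ 0 := by positivity
  field_simp

/-- The integrand of an ordinary convolution is integrable on the product space. -/
theorem integrable_mul_comp_sub {f g : ℝ → ℝ} (hf : Integrable f) (hg : Integrable g) :
    Integrable (fun p : ℝ × ℝ => f p.2 * g (p.1 - p.2)) (volume.prod volume) :=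
  Integrable.convolution_integrand (ContinuousLinearMap.mul ℝ ℝ) hf hg

theorem integral_gaussian_mul_cos_add_sin {c : ℝ} (hc : 0 < c) (A B y : ℝ) :
    ∫ s, (A * Real.cos (s * y) + B * Real.sin (s * y)) * Real.exp (-c * s ^ 2) =
      A * (√(π / c) * Real.exp (-(y ^ 2 / (4 * c)))) := by
  have hexp : Integrable (fun s : ℝ => Real.exp (-c * s ^ 2)) := integrable_exp_neg_mul_sq hc
  have icos : Integrable (fun s : ℝ => Real.cos (s * y) * Real.exp (-c * s ^ 2)) :=
    hexp.bdd_mul (c := 1) (by fun_prop) (Eventually.of_forall fun s => Real.abs_cos_le_one _)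
  have isin : Integrable (fun s : ℝ => Real.sin (s * y) * Real.exp (-c * s ^ 2)) :=
    hexp.bdd_mul (c := 1) (by fun_prop) (Eventually.of_forall fun s => Real.abs_sin_le_one _)
  have key := fourierIntegral_gaussian (b := (c : ℂ)) (by simpa using hc) (y : ℂ)
  have hint : ∀ s : ℝ, Complex.exp (Complex.I * y * s) * Complex.exp (-c * s ^ 2) =
      ((Real.cos (s * y) * Real.exp (-c * s ^ 2) : ℝ) : ℂ) +
        ((Real.sin (s * y) * Real.exp (-c * s ^ 2) : ℝ) : ℂ) * Complex.I := by
    intro s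
    rw [show Complex.I * y * s = ((s * y : ℝ) : ℂ) * Complex.I by push_cast; ring,
      Complex.exp_mul_I]
    push_cast
    ring
  have hrhs : ((π : ℂ) / c) ^ (1 / 2 : ℂ) * Complex.exp (-(y : ℂ) ^ 2 / (4 * c)) =
      ((√(π / c) * Real.exp (-(y ^ 2 / (4 * c))) : ℝ) : ℂ) := by
    rw [Real.sqrt_eq_rpow]
    push_cast [Complex.ofReal_cpow (div_pos Real.pi_pos hc).le]
    rw [neg_div]
  rw [integral_congr_ae (Eventually.of_forall hint), hrhs,
    integral_add icos.ofReal (isin.ofReal.mul_const _), integral_mul_const,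
    integral_complex_ofReal, integral_complex_ofReal] at key
  have hre := congrArg Complex.re key
  have him := congrArg Complex.im key
  simp only [Complex.add_re, Complex.add_im, Complex.mul_re, Complex.mul_im,
    Complex.ofReal_re, Complex.ofReal_im, Complex.I_re, Complex.I_im, mul_zero, mul_one,
    sub_zero, add_zero, zero_add] at hre him
  have hsplit : ∀ s : ℝ,
      (A * Real.cos (s * y) + B * Real.sin (s * y)) * Real.exp (-c * s ^ 2) =
        A * (Real.cos (s * y) * Real.exp (-c * s ^ 2)) +
          B * (Real.sin (s * y) * Real.exp (-c * s ^ 2)) := fun s => by ring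
  rw [integral_congr_ae (Eventually.of_forall hsplit),
    integral_add (icos.const_mul A) (isin.const_mul B), integral_const_mul, integral_const_mul]
  rw [hre, him]
  ring

/-- The trigonometric kernel is an eigenfunction of convolution with a Gaussian. -/
theorem integral_cas_mul_gaussian_sub {c : ℝ} (hc : 0 < c) (a b y v : ℝ) :
    ∫ x, (a * Real.cos (x * y) + b * Real.sin (x * y)) * Real.exp (-c * (x - v) ^ 2) =
      (√(π / c) * Real.exp (-(y ^ 2 / (4 * c)))) *
        (a * Real.cos (v * y) + b * Real.sin (v * y)) := by
  rw [← integral_add_right_eq_self _ v]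
  have h := integral_gaussian_mul_cos_add_sin hc (a * Real.cos (v * y) + b * Real.sin (v * y))
    (b * Real.cos (v * y) - a * Real.sin (v * y)) y
  rw [mul_comm, ← h]
  congr 1 with s
  rw [add_sub_cancel_right, add_mul s v y, Real.cos_add, Real.sin_add]
  ring

theorem integral_cas_mul_gaussian_convolution {c : ℝ} (hc : 0 < c) (a b y : ℝ) {φ : ℝ → ℝ}
    (hφ : Integrable φ) :
    ∫ x, (a * Real.cos (x * y) + b * Real.sin (x * y)) *
        ∫ v, φ v * Real.exp (-c * (x - v) ^ 2) =
      (√(π / c) * Real.exp (-(y ^ 2 / (4 * c)))) *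
        ∫ v, (a * Real.cos (v * y) + b * Real.sin (v * y)) * φ v := by
  have hprod := integrable_mul_comp_sub hφ (integrable_exp_neg_mul_sq hc)
  have hint : Integrable (fun p : ℝ × ℝ =>
      (a * Real.cos (p.1 * y) + b * Real.sin (p.1 * y)) *
        (φ p.2 * Real.exp (-c * (p.1 - p.2) ^ 2))) (volume.prod volume) := by
    refine hprod.bdd_mul (c := |a| + |b|) (by fun_prop) (Eventually.of_forall fun p => ?_)
    refine (norm_add_le _ _).trans (add_le_add ?_ ?_)
    · rw [norm_mul]
      exact mul_le_of_le_one_right (abs_nonneg _) (Real.abs_cos_le_one _)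
    · rw [norm_mul]
      exact mul_le_of_le_one_right (abs_nonneg _) (Real.abs_sin_le_one _)
  simp_rw [← integral_const_mul]
  rw [integral_integral_swap hint]
  congr 1 with v
  rw [← mul_assoc, ← integral_cas_mul_gaussian_sub hc, ← integral_mul_const]
  congr 1 with x
  ring

theorem stmt19 (a b : ℝ) (ha : a ≠ 0)
    (hab : a ^ 2 + b ^ 2 ≠ 0) (hab1 : a ≠ b) (hab2 : a ≠ -b)
    (κ t : ℝ) (hκ : 0 < κ) (ht : 0 < t)
    (φ : ℝ → ℝ) (hφ : Integrable φ volume) :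
    Integrable
      (fun x => (1 / (a * Real.sqrt 2)) *
        Hconv1 a b (fun ξ => (κ * t) ^ (-(1 : ℝ) / 2) * Real.exp (-(ξ ^ 2 / (4 * κ * t)))) φ x)
      volume ∧
    ∀ y : ℝ,
      Htransform1 a b
        (fun x => (1 / (a * Real.sqrt 2)) *
          Hconv1 a b (fun ξ => (κ * t) ^ (-(1 : ℝ) / 2) * Real.exp (-(ξ ^ 2 / (4 * κ * t)))) φ x) y =
        Real.exp (-(κ * t * y ^ 2)) * Htransform1 a b φ y := by
  have hc : 0 < 1 / (4 * κ * t) := by positivity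
  have hu : (fun x => (1 / (a * Real.sqrt 2)) *
      Hconv1 a b (fun ξ => (κ * t) ^ (-(1 : ℝ) / 2) * Real.exp (-(ξ ^ 2 / (4 * κ * t)))) φ x) =
      fun x => (√(π / (1 / (4 * κ * t))))⁻¹ *
        ∫ v, φ v * Real.exp (-(1 / (4 * κ * t)) * (x - v) ^ 2) := by
    have hconst : (√(π / (1 / (4 * κ * t))))⁻¹ =
        (1 / (a * √2)) * (a / (2 * π) ^ ((1 : ℝ) / 2)) * (κ * t) ^ (-(1 : ℝ) / 2) := by
      rw [neg_div, Real.rpow_neg (by positivity), ← Real.sqrt_eq_rpow, ← Real.sqrt_eq_rpow,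
        show π / (1 / (4 * κ * t)) = 2 * (2 * π) * (κ * t) by field_simp; ring,
        Real.sqrt_mul (by positivity), Real.sqrt_mul (by positivity)]
      field_simp
    funext x
    have hv : ∀ v, φ v * ((κ * t) ^ (-(1 : ℝ) / 2) * Real.exp (-((x - v) ^ 2 / (4 * κ * t)))) =
        (κ * t) ^ (-(1 : ℝ) / 2) * (φ v * Real.exp (-(1 / (4 * κ * t)) * (x - v) ^ 2)) := by
      intro v
      rw [show -((x - v) ^ 2 / (4 * κ * t)) = -(1 / (4 * κ * t)) * (x - v) ^ 2 by ring]
      ring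
    rw [Hconv1_of_even a b (fun ξ => by simp only [neg_sq]), hconst,
      integral_congr_ae (Eventually.of_forall hv), integral_const_mul]
    ring
  rw [hu]
  refine ⟨(integrable_mul_comp_sub hφ (integrable_exp_neg_mul_sq hc)).integral_prod_left.const_mul _,
    fun y => ?_⟩
  have hs : √(π / (1 / (4 * κ * t))) ≠ 0 := by positivity
  simp only [Htransform1, mul_left_comm _ (√(π / (1 / (4 * κ * t))))⁻¹, integral_const_mul]
  rw [integral_cas_mul_gaussian_convolution hc a b y hφ,
    show y ^ 2 / (4 * (1 / (4 * κ * t))) = κ * t * y ^ 2 by field_simp]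
  field_simp
end
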